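/- For every word u over a nonempty finite alphabet A, h(u) equals 1 plus the maximum, taken over all factorizations u = u₁·u₂ and all letters a ∈ A, of δ(u, u₁·a·u₂); equivalently, h(u) = max over factorizations u = u₁·u₂ and letters a ∈ A of r(u₁,a) + ℓ(a,u₂) + 1. -/

import Mathlib

/-- Simon's congruence of order `k`: `u` and `v` have the same subwords
(subsequences) of length at most `k`. -/
def SimonCong {A : Type*} (k : ℕ) (u v : List A) : Prop :=
  ∀ s : List A, s.length ≤ k → (s.Sublist u ↔ s.Sublist v)

/-- The subword distance `δ(u,v) = sup {k | u ∼ₖ v} ∈ ℕ ∪ {∞}`. -/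
noncomputable def delta {A : Type*} (u v : List A) : ℕ∞ :=
  ⨆ k ∈ {k : ℕ | SimonCong k u v}, (k : ℕ∞)

/-- Right side distance `r(u,t) = δ(u, u·t)`. -/
noncomputable def sideR {A : Type*} (u t : List A) : ℕ∞ :=
  delta u (u ++ t)

/-- Left side distance `ℓ(t,u) = δ(t·u, u)`. -/
noncomputable def sideL {A : Type*} (t u : List A) : ℕ∞ :=
  delta (t ++ u) u

/-- The piecewise complexity `h(u)`: the least `n` such that every word
`v` with `u ∼ₙ v` equals `u`. -/
noncomputable def pieceH {A : Type*} (u : List A) : ℕ :=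
  sInf {n : ℕ | ∀ v : List A, SimonCong n u v → v = u}

/-- A word `u` is `m`-reduced if no strict subword of `u` is `∼ₘ`-equivalent to `u`. -/
def MReduced {A : Type*} (m : ℕ) (u : List A) : Prop :=
  ∀ u' : List A, u'.Sublist u → u' ≠ u → ¬ SimonCong m u' u

/-- The piecewise minimality index `ρ(u)`: the least `m` such that `u` is `m`-reduced. -/
noncomputable def rho {A : Type*} (u : List A) : ℕ :=
  sInf {m : ℕ | MReduced m u}

theorem SimonCong.symm {A : Type*} {k : ℕ} {u v : List A} (h : SimonCong k u v) :
    SimonCong k v u := fun s hs => (h s hs).symm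

theorem SimonCong.trans {A : Type*} {k : ℕ} {u v w : List A} (h : SimonCong k u v)
    (h' : SimonCong k v w) : SimonCong k u w := fun s hs => (h s hs).trans (h' s hs)

theorem SimonCong.mono {A : Type*} {k m : ℕ} {u v : List A} (h : SimonCong m u v) (hk : k ≤ m) :
    SimonCong k u v := fun s hs => h s (hs.trans hk)

theorem SimonCong.of_forall {A : Type*} {k : ℕ} {u v : List A} (huv : u.Sublist v)
    (h : ∀ s : List A, s.length ≤ k → s.Sublist v → s.Sublist u) : SimonCong k u v :=
  fun s hs => ⟨fun hu => hu.trans huv, h s hs⟩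

theorem SimonCong.sandwich {A : Type*} {k : ℕ} {u v w : List A} (h : SimonCong k u w)
    (huv : u.Sublist v) (hvw : v.Sublist w) : SimonCong k u v :=
  .of_forall huv fun s hs hv => (h s hs).2 (hv.trans hvw)

theorem List.append_sublist_append_cons {A : Type*} (x : List A) (a : A) (y : List A) :
    (x ++ y).Sublist (x ++ a :: y) :=
  (List.Sublist.refl x).append (List.sublist_cons_self a y)

/-- A subword of `x·a·y` that is not a subword of `x·y` must use the inserted letter. -/
theorem List.Sublist.exists_of_not_sublist_append {A : Type*} {w x y : List A} {a : A}
    (h : w.Sublist (x ++ a :: y)) (h' : ¬ w.Sublist (x ++ y)) :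
    ∃ s t, w = s ++ a :: t ∧ s.Sublist x ∧ t.Sublist y ∧
      ¬ (s ++ [a]).Sublist x ∧ ¬ (a :: t).Sublist y := by
  obtain ⟨s, r, rfl, hs, hr⟩ := List.sublist_append_iff.1 h
  rcases List.sublist_cons_iff.1 hr with hr | ⟨t, rfl, ht⟩
  · exact absurd (hs.append hr) h'
  · refine ⟨s, t, rfl, hs, ht, fun hx => h' ?_, fun hy => h' (hs.append hy)⟩
    simpa using hx.append ht

theorem List.Sublist.of_append_cons_sublist_append {A : Type*} {s t x y : List A} {a : A}
    (h : (s ++ a :: t).Sublist (x ++ y)) : (s ++ [a]).Sublist x ∨ (a :: t).Sublist y := by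
  obtain ⟨p, q, hpq, hp, hq⟩ := List.sublist_append_iff.1 h
  rcases List.append_eq_append_iff.1 hpq with ⟨c, rfl, hc⟩ | ⟨c, rfl, rfl⟩
  · cases c with
    | nil => right; simpa [hc] using hq
    | cons b c =>
      obtain ⟨rfl, rfl⟩ := by simpa using hc
      left
      exact ((List.Sublist.refl s).append (by simp)).trans hp
  · right
    exact (List.sublist_append_right _ _).trans hq

/-- If inserting `a` preserves the class of a word, it can be inserted a second time. -/
theorem SimonCong.insert_twice {A : Type*} {k : ℕ} {x y : List A} {a : A}
    (h : SimonCong k (x ++ y) (x ++ a :: y)) :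
    SimonCong k (x ++ a :: y) (x ++ a :: a :: y) := by
  refine .of_forall (List.append_sublist_append_cons x a (a :: y)) fun w hw hs => ?_
  by_contra hn
  obtain ⟨s, t, rfl, hsx, ht, hx, hy⟩ := hs.exists_of_not_sublist_append hn
  rcases List.sublist_cons_iff.1 ht with ht | ⟨t, rfl, hty⟩
  · exact hy (ht.cons_cons a)
  · simp only [List.length_append, List.length_cons] at hw
    have h1 : (s ++ a :: t).Sublist (x ++ y) :=
      (h _ (by simp only [List.length_append, List.length_cons]; omega)).2
        (hsx.append (hty.cons_cons a))
    rcases h1.of_append_cons_sublist_append with h2 | h2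
    · exact hx h2
    · exact hy (h2.cons_cons a)

/-- At the first position where two congruent words differ, one of the two words accepts the
letter of the other one. -/
theorem SimonCong.insert_or_insert {A : Type*} {n : ℕ} {p u v : List A} {a b : A} (hab : a ≠ b)
    (h : SimonCong n (p ++ a :: u) (p ++ b :: v)) :
    SimonCong n (p ++ a :: u) (p ++ b :: a :: u) ∨
      SimonCong n (p ++ b :: v) (p ++ a :: b :: v) := by
  -- the core of the argument, stated so as to apply to both words
  have key : ∀ {u v : List A} {a b : A}, a ≠ b → SimonCong n (p ++ a :: u) (p ++ b :: v) →
      ∀ {s s' t : List A}, s.Sublist p → s'.Sublist p → ¬ (s ++ [b]).Sublist p →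
      ¬ (s' ++ [a]).Sublist p → t.Sublist (a :: u) → ¬ (b :: t).Sublist (a :: u) →
      (s ++ b :: t).length ≤ n → (s' ++ a :: t).length ≤ n → False := by
    intro u v a b hab h s s' t hs hs' hsb hsa ht hbt hl hl'
    have htv : ¬ t.Sublist v := fun htv =>
      (((h _ hl).2 (hs.append (htv.cons_cons b))).of_append_cons_sublist_append).elim hsb hbt
    have aux : ∀ r : List A, (s' ++ a :: r).Sublist (p ++ b :: v) → (a :: r).Sublist v := by
      intro r hr
      rcases hr.of_append_cons_sublist_append with h1 | h1
      · exact absurd h1 hsa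
      · rcases List.sublist_cons_iff.1 h1 with h1 | ⟨_, h2, _⟩
        · exact h1
        · exact absurd (List.cons.inj h2).1 hab
    rcases List.sublist_cons_iff.1 ht with ht | ⟨t, rfl, htu⟩
    · exact htv ((List.sublist_cons_self a t).trans
        (aux t ((h _ hl').1 (hs'.append (ht.cons_cons a)))))
    · refine htv (aux t ((h _ ?_).1 (hs'.append (htu.cons_cons a))))
      simp only [List.length_append, List.length_cons] at hl' ⊢
      omega
  by_contra! hcon
  obtain ⟨h1, h2⟩ := hcon
  have get : ∀ {y : List A} {c : A}, ¬ SimonCong n (p ++ y) (p ++ c :: y) →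
      ∃ s t, (s ++ c :: t).length ≤ n ∧ s.Sublist p ∧ t.Sublist y ∧
        ¬ (s ++ [c]).Sublist p ∧ ¬ (c :: t).Sublist y := by
    intro y c hc
    by_contra! hno
    refine hc (.of_forall (List.append_sublist_append_cons p c y) fun w hw hs => ?_)
    by_contra hn
    obtain ⟨s, t, rfl, e1, e2, e3, e4⟩ := hs.exists_of_not_sublist_append hn
    exact e4 (hno s t hw e1 e2 e3)
  obtain ⟨s, t, hl, hs, ht, hsb, hbt⟩ := get h1
  obtain ⟨s', t', hl', hs', ht', hsa, hat⟩ := get h2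
  by_cases hlen : (s' ++ a :: t).length ≤ n
  · exact key hab h hs hs' hsb hsa ht hbt hl hlen
  · refine key hab.symm h.symm hs' hs hsa hsb ht' hat hl' ?_
    simp only [List.length_append, List.length_cons] at hl hl' hlen ⊢
    omega

/-- A word whose class is not a singleton is congruent to one of its one-letter insertions. -/
theorem SimonCong.exists_insert {A : Type*} {n : ℕ} {p u v : List A}
    (h : SimonCong n (p ++ u) (p ++ v)) (hne : u ≠ v) :
    ∃ x y a, p ++ u = x ++ y ∧ SimonCong n (x ++ y) (x ++ a :: y) := by
  induction u generalizing p v with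
  | nil =>
    cases v with
    | nil => exact absurd rfl hne
    | cons b v =>
      exact ⟨p, [], b, rfl, h.sandwich (by simp) (by simp)⟩
  | cons a u ih =>
    cases v with
    | nil =>
      have h1 : SimonCong n (p ++ u) (p ++ a :: u) := fun w hw =>
        ⟨fun hu => hu.trans (List.append_sublist_append_cons p a u), fun hu =>
          ((h w hw).1 hu).trans (by simp)⟩
      exact ⟨p, a :: u, a, rfl, h1.insert_twice⟩
    | cons b v =>
      by_cases hab : a = b
      · subst hab
        have := ih (p := p ++ [a]) (v := v) (by simpa using h) (fun e => hne (by rw [e]))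
        simpa using this
      · rcases h.insert_or_insert hab with h1 | h1
        · exact ⟨p, a :: u, b, rfl, h1⟩
        · by_cases hu : u = b :: v
          · subst hu
            exact ⟨p, a :: b :: v, a, rfl, h1.insert_twice⟩
          · have := ih (p := p ++ [a]) (v := b :: v) (by simpa using h.trans h1) hu
            simpa using this

theorem le_delta_iff {A : Type*} {k : ℕ} {u v : List A} :
    (k : ℕ∞) ≤ delta u v ↔ SimonCong k u v := by
  refine ⟨fun h => ?_, fun h => le_iSup₂_of_le k h le_rfl⟩
  cases k with
  | zero =>
    intro s hs
    simp [List.length_eq_zero_iff.1 (Nat.le_zero.1 hs)]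
  | succ k =>
    have hlt : (k : ℕ∞) < delta u v := lt_of_lt_of_le (by exact_mod_cast Nat.lt_succ_self k) h
    simp only [delta, lt_iSup_iff] at hlt
    obtain ⟨m, hm, hkm⟩ := hlt
    exact SimonCong.mono hm (by exact_mod_cast hkm)

theorem delta_lt_top {A : Type*} {u v : List A} (h : u.length < v.length) :
    delta u v < ⊤ := by
  have : ¬ ((v.length : ℕ) : ℕ∞) ≤ delta u v := by
    rw [le_delta_iff]
    intro hc
    have := ((hc v le_rfl).2 (List.Sublist.refl v)).length_le
    omega
  exact lt_of_lt_of_le (not_le.1 this) le_top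

theorem delta_comm {A : Type*} (u v : List A) : delta u v = delta v u :=
  ENat.eq_of_forall_natCast_le_iff fun _ =>
    le_delta_iff.trans (⟨SimonCong.symm, SimonCong.symm⟩ : _ ↔ _) |>.trans le_delta_iff.symm

theorem delta_insert {A : Type*} (x y : List A) (a : A) :
    delta (x ++ y) (x ++ a :: y) = sideR x [a] + sideL [a] y := by
  obtain ⟨R, hR⟩ := ENat.ne_top_iff_exists.1
    (delta_lt_top (u := x) (v := x ++ [a]) (by simp)).ne
  obtain ⟨L, hL⟩ := ENat.ne_top_iff_exists.1
    (delta_lt_top (u := y) (v := [a] ++ y) (by simp)).ne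
  have hR' : ∀ k : ℕ, SimonCong k x (x ++ [a]) ↔ k ≤ R := fun k => by
    rw [← le_delta_iff, ← hR, Nat.cast_le]
  have hL' : ∀ k : ℕ, SimonCong k y (a :: y) ↔ k ≤ L := fun k => by
    rw [← List.singleton_append, ← le_delta_iff, ← hL, Nat.cast_le]
  rw [sideR, sideL, delta_comm ([a] ++ y), ← hR, ← hL]
  refine ENat.eq_of_forall_natCast_le_iff fun k => ?_
  rw [le_delta_iff, ← Nat.cast_add, Nat.cast_le]
  constructor
  · intro h
    by_contra! hlt
    have hr : ¬ SimonCong (R + 1) x (x ++ [a]) := by rw [hR']; omega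
    have hl : ¬ SimonCong (L + 1) y (a :: y) := by rw [hL']; omega
    refine hr (.of_forall (by simp) fun w hw hwx => ?_)
    by_contra hwn
    refine hl (.of_forall (by simp) fun z hz hzy => ?_)
    by_contra hzn
    obtain ⟨s, t, rfl, hs, ht, hsa, -⟩ :=
      hwx.exists_of_not_sublist_append (by simpa using hwn)
    obtain rfl := List.sublist_nil.1 ht
    rcases List.sublist_cons_iff.1 hzy with hzy | ⟨t, rfl, ht⟩
    · exact hzn hzy
    · simp only [List.length_append, List.length_cons, List.length_nil] at hw hz
      have := (h (s ++ a :: t)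
        (by simp only [List.length_append, List.length_cons]; omega)).2
        (hs.append (ht.cons_cons a))
      exact this.of_append_cons_sublist_append.elim hsa hzn
  · intro hk
    refine .of_forall (List.append_sublist_append_cons x a y) fun w hw hs => ?_
    by_contra hn
    obtain ⟨s, t, rfl, hs, ht, hsa, hat⟩ := hs.exists_of_not_sublist_append hn
    have h1 : ¬ s.length + 1 ≤ R := fun h1 => hsa <|
      ((hR' _).2 h1 (s ++ [a]) (by simp)).2 (hs.append (List.Sublist.refl _))
    have h2 : ¬ t.length + 1 ≤ L := fun h2 => hat <|
      ((hL' _).2 h2 (a :: t) (by simp)).2 (ht.cons_cons a)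
    simp only [List.length_append, List.length_cons] at hw
    omega

theorem forall_simonCong_imp_eq_iff {A : Type*} (n : ℕ) (u : List A) :
    (∀ v, SimonCong n u v → v = u) ↔
      ∀ x y a, u = x ++ y → delta u (x ++ a :: y) < n := by
  constructor
  · rintro h x y a rfl
    rw [← not_le, le_delta_iff]
    intro hc
    simpa using congrArg List.length (h _ hc)
  · intro h v hv
    by_contra hne
    obtain ⟨x, y, a, hu, hc⟩ := SimonCong.exists_insert (p := []) hv (Ne.symm hne)
    rw [List.nil_append] at hu
    subst hu
    exact (h x y a rfl).not_ge (le_delta_iff.2 hc)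

theorem pieceH_spec {A : Type*} (u v : List A) (h : SimonCong (pieceH u) u v) : v = u := by
  refine Nat.sInf_mem (s := {n : ℕ | ∀ v : List A, SimonCong n u v → v = u})
    ⟨u.length + 1, ?_⟩ v h
  rw [Set.mem_ofPred_eq, forall_simonCong_imp_eq_iff]
  rintro x y a rfl
  rw [← not_le, le_delta_iff]
  intro hc
  have := ((hc (x ++ a :: y) (by simp; omega)).2 (List.Sublist.refl _)).length_le
  simp at this

theorem pieceH_eq_iSup_delta_add_one {A : Type*} [Nonempty A] (u : List A) :
    (pieceH u : ℕ∞) =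
      ⨆ p : {p : List A × List A × A // u = p.1 ++ p.2.1},
        (delta u (p.val.1 ++ p.val.2.2 :: p.val.2.1) + 1) := by
  have hlt := (forall_simonCong_imp_eq_iff (pieceH u) u).1 (pieceH_spec u)
  apply le_antisymm
  · cases hn : pieceH u with
    | zero => simp
    | succ n =>
      have hmin : n ∉ {n : ℕ | ∀ v : List A, SimonCong n u v → v = u} :=
        Nat.notMem_of_lt_sInf (show n < pieceH u by omega)
      rw [Set.mem_ofPred_eq, forall_simonCong_imp_eq_iff] at hmin
      push Not at hmin
      obtain ⟨x, y, a, hu, hle⟩ := hmin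
      refine le_iSup_of_le ⟨(x, y, a), hu⟩ ?_
      push_cast
      gcongr
  · exact iSup_le fun p => Order.add_one_le_of_lt (hlt _ _ _ p.2)

theorem stmt1 {A : Type*} [Fintype A] [Nonempty A] (u : List A) :
    (pieceH u : ℕ∞) =
      (⨆ p : {p : List A × List A × A // u = p.1 ++ p.2.1},
        delta u (p.val.1 ++ p.val.2.2 :: p.val.2.1)) + 1 ∧
    (pieceH u : ℕ∞) =
      ⨆ p : {p : List A × List A × A // u = p.1 ++ p.2.1},
        sideR p.val.1 [p.val.2.2] + sideL [p.val.2.2] p.val.2.1 + 1 := by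
  obtain ⟨a⟩ := ‹Nonempty A›
  have : Nonempty A := ⟨a⟩
  have : Nonempty {p : List A × List A × A // u = p.1 ++ p.2.1} := ⟨⟨([], u, a), rfl⟩⟩
  refine ⟨?_, ?_⟩
  · rw [ENat.iSup_add, pieceH_eq_iSup_delta_add_one]
  · rw [pieceH_eq_iSup_delta_add_one]
    refine iSup_congr fun p => ?_
    rw [← delta_insert, ← p.2]
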